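/- In F(3), the foliations H₂, H₈, H₁₁ and F₅ do not degenerate onto F₁ (i.e. F₁ does not belong to the closure of any of their orbits), and the foliations H₅ and H₉ do not degenerate onto F₂, where these foliations are given in the affine chart z = 1 by: H₂: x³dx − y³dy; H₅: 2y³dx + x²(3y−2x)dy; H₈: x(x²−3y²)dx − 4y³dy; H₉: y²((−3+i√3)x+2y)dx + x²((1+i√3)x − 2i√3·y)dy; H₁₁: (3x³+3√3x²y+3xy²+√3y³)dx + (√3x³+3x²y+3√3xy²+3y³)dy; F₁: y³dx + x³(x dy − y dx); F₂: x³dx + y³(x dy − y dx); F₅: y²(y dx + 2x dy) + x³(x dy − y dx). -/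

import Mathlib

open MvPolynomial

noncomputable section

/-- Substitution of the linear change of variables on `ℂ³` given by the matrix `M`. -/
def subst3 (M : Matrix (Fin 3) (Fin 3) ℂ) (P : MvPolynomial (Fin 3) ℂ) :
    MvPolynomial (Fin 3) ℂ :=
  aeval (fun i => ∑ j, C (M i j) * X j) P

/-- Pullback of the 1-form with coefficient vector `Ω` by the linear map of matrix `M`. -/
def pb3 (M : Matrix (Fin 3) (Fin 3) ℂ) (Ω : Fin 3 → MvPolynomial (Fin 3) ℂ) :
    Fin 3 → MvPolynomial (Fin 3) ℂ :=
  fun i => ∑ j, C (M j i) * subst3 M (Ω j)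

/-- Two foliations (given by their projective 1-forms) are linearly conjugate:
`T*Ω = c·Ω'` for some `T ∈ GL₃(ℂ)` and `c ∈ ℂ*`. -/
def LinConj3 (Ω Ω' : Fin 3 → MvPolynomial (Fin 3) ℂ) : Prop :=
  ∃ (M : Matrix (Fin 3) (Fin 3) ℂ) (c : ℂ), IsUnit M.det ∧ c ≠ 0 ∧
    pb3 M Ω = fun i => C c * Ω' i

/-- The orbit of the 1-form `Ω` under pullback by `GL₃(ℂ)` and nonzero rescaling
(the cone over the `PGL₃(ℂ)`-orbit of the corresponding foliation). -/
def OrbitOf (Ω : Fin 3 → MvPolynomial (Fin 3) ℂ) :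
    Set (Fin 3 → MvPolynomial (Fin 3) ℂ) :=
  {Ω' | LinConj3 Ω Ω'}

/-- `Ω` defines a degree-`d` foliation of `ℙ²(ℂ)`: it is a nonzero 1-form with
homogeneous coefficients of degree `d + 1` annihilating the radial vector field and
with no common factor. -/
def IsFolDeg (d : ℕ) (Ω : Fin 3 → MvPolynomial (Fin 3) ℂ) : Prop :=
  Ω ≠ 0 ∧ (∀ i, (Ω i).IsHomogeneous (d + 1)) ∧
    X 0 * Ω 0 + X 1 * Ω 1 + X 2 * Ω 2 = 0 ∧
    ∀ h : MvPolynomial (Fin 3) ℂ, (∀ i, h ∣ Ω i) → IsUnit h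

/-- The coefficient vector of a triple of polynomials. -/
def coeffs (Ω : Fin 3 → MvPolynomial (Fin 3) ℂ) : Fin 3 → (Fin 3 →₀ ℕ) → ℂ :=
  fun i m => coeff m (Ω i)

/-- Closure, inside the space `F(d)` of degree-`d` foliations with its classical
topology (read off on the coefficients), of a set of defining 1-forms. -/
def FClos (d : ℕ) (S : Set (Fin 3 → MvPolynomial (Fin 3) ℂ)) :
    Set (Fin 3 → MvPolynomial (Fin 3) ℂ) :=
  {Ω' | IsFolDeg d Ω' ∧ coeffs Ω' ∈ closure (coeffs '' S)}

/-- `√3` as a complex number. -/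
def s3 : ℂ := (Real.sqrt 3 : ℝ)

/-- Projective 1-form of `H₁ : y³dx − x³dy`. -/
def OmH1 : Fin 3 → MvPolynomial (Fin 3) ℂ :=
  ![X 2 * X 1 ^ 3, -(X 2 * X 0 ^ 3), X 0 ^ 3 * X 1 - X 0 * X 1 ^ 3]

/-- Projective 1-form of `H₂ : x³dx − y³dy`. -/
def OmH2 : Fin 3 → MvPolynomial (Fin 3) ℂ :=
  ![X 2 * X 0 ^ 3, -(X 2 * X 1 ^ 3), X 1 ^ 4 - X 0 ^ 4]

/-- Projective 1-form of `H₃ : y²(3x+y)dx − x²(x+3y)dy`. -/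
def OmH3 : Fin 3 → MvPolynomial (Fin 3) ℂ :=
  ![X 2 * (3 * X 0 * X 1 ^ 2 + X 1 ^ 3), -(X 2 * (X 0 ^ 3 + 3 * X 0 ^ 2 * X 1)),
    X 0 ^ 3 * X 1 - X 0 * X 1 ^ 3]

/-- Projective 1-form of `H₄ : y²(3x+y)dx + x²(x+3y)dy`. -/
def OmH4 : Fin 3 → MvPolynomial (Fin 3) ℂ :=
  ![X 2 * (3 * X 0 * X 1 ^ 2 + X 1 ^ 3), X 2 * (X 0 ^ 3 + 3 * X 0 ^ 2 * X 1),
    -(X 0 ^ 3 * X 1 + 6 * X 0 ^ 2 * X 1 ^ 2 + X 0 * X 1 ^ 3)]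

/-- Projective 1-form of `H₅ : 2y³dx + x²(3y−2x)dy`. -/
def OmH5 : Fin 3 → MvPolynomial (Fin 3) ℂ :=
  ![2 * X 2 * X 1 ^ 3, X 2 * (3 * X 0 ^ 2 * X 1 - 2 * X 0 ^ 3),
    -(2 * X 0 * X 1 ^ 3 + 3 * X 0 ^ 2 * X 1 ^ 2 - 2 * X 0 ^ 3 * X 1)]

/-- Projective 1-form of `H₆ : (4x³−6x²y+4y³)dx + x²(3y−2x)dy`. -/
def OmH6 : Fin 3 → MvPolynomial (Fin 3) ℂ :=
  ![X 2 * (4 * X 0 ^ 3 - 6 * X 0 ^ 2 * X 1 + 4 * X 1 ^ 3),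
    X 2 * (3 * X 0 ^ 2 * X 1 - 2 * X 0 ^ 3),
    -(4 * X 0 ^ 4 - 8 * X 0 ^ 3 * X 1 + 3 * X 0 ^ 2 * X 1 ^ 2 + 4 * X 0 * X 1 ^ 3)]

/-- Projective 1-form of `H₇ : y³dx + x(3y²−x²)dy`. -/
def OmH7 : Fin 3 → MvPolynomial (Fin 3) ℂ :=
  ![X 2 * X 1 ^ 3, X 2 * (3 * X 0 * X 1 ^ 2 - X 0 ^ 3),
    X 0 ^ 3 * X 1 - 4 * X 0 * X 1 ^ 3]

/-- Projective 1-form of `H₈ : x(x²−3y²)dx − 4y³dy`. -/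
def OmH8 : Fin 3 → MvPolynomial (Fin 3) ℂ :=
  ![X 2 * (X 0 ^ 3 - 3 * X 0 * X 1 ^ 2), -(4 * X 2 * X 1 ^ 3),
    -(X 0 ^ 4 - 3 * X 0 ^ 2 * X 1 ^ 2 - 4 * X 1 ^ 4)]

/-- Projective 1-form of `H₉ : y²((−3+i√3)x+2y)dx + x²((1+i√3)x−2i√3·y)dy`. -/
def OmH9 : Fin 3 → MvPolynomial (Fin 3) ℂ :=
  ![X 2 * (C (-3 + Complex.I * s3) * X 0 * X 1 ^ 2 + 2 * X 1 ^ 3),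
    X 2 * (C (1 + Complex.I * s3) * X 0 ^ 3 - C (2 * (Complex.I * s3)) * X 0 ^ 2 * X 1),
    -(C (1 + Complex.I * s3) * X 0 ^ 3 * X 1 + C (-3 - Complex.I * s3) * X 0 ^ 2 * X 1 ^ 2 +
      2 * X 0 * X 1 ^ 3)]

/-- Projective 1-form of
`H₁₁ : (3x³+3√3x²y+3xy²+√3y³)dx + (√3x³+3x²y+3√3xy²+3y³)dy`. -/
def OmH11 : Fin 3 → MvPolynomial (Fin 3) ℂ :=
  ![X 2 * (3 * X 0 ^ 3 + C (3 * s3) * X 0 ^ 2 * X 1 + 3 * X 0 * X 1 ^ 2 + C s3 * X 1 ^ 3),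
    X 2 * (C s3 * X 0 ^ 3 + 3 * X 0 ^ 2 * X 1 + C (3 * s3) * X 0 * X 1 ^ 2 + 3 * X 1 ^ 3),
    -(3 * X 0 ^ 4 + C (4 * s3) * X 0 ^ 3 * X 1 + 6 * X 0 ^ 2 * X 1 ^ 2 +
      C (4 * s3) * X 0 * X 1 ^ 3 + 3 * X 1 ^ 4)]

/-- Projective 1-form of `F₁ : y³dx + x³(x dy − y dx)`. -/
def OmF1 : Fin 3 → MvPolynomial (Fin 3) ℂ :=
  ![X 2 * X 1 ^ 3 - X 0 ^ 3 * X 1, X 0 ^ 4, -(X 0 * X 1 ^ 3)]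

/-- Projective 1-form of `F₂ : x³dx + y³(x dy − y dx)`. -/
def OmF2 : Fin 3 → MvPolynomial (Fin 3) ℂ :=
  ![X 2 * X 0 ^ 3 - X 1 ^ 4, X 0 * X 1 ^ 3, -(X 0 ^ 4)]

/-- Projective 1-form of the Fermat foliation `F₃ : (x³−x)dy − (y³−y)dx`. -/
def OmF3 : Fin 3 → MvPolynomial (Fin 3) ℂ :=
  ![X 1 * X 2 ^ 3 - X 1 ^ 3 * X 2, X 0 ^ 3 * X 2 - X 0 * X 2 ^ 3,
    X 0 * X 1 ^ 3 - X 0 ^ 3 * X 1]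

/-- Projective 1-form of `F₄ : (x³+y³)dx + x³(x dy − y dx)`. -/
def OmF4 : Fin 3 → MvPolynomial (Fin 3) ℂ :=
  ![X 2 * (X 0 ^ 3 + X 1 ^ 3) - X 0 ^ 3 * X 1, X 0 ^ 4, -(X 0 ^ 4 + X 0 * X 1 ^ 3)]

/-- Projective 1-form of `F₅ : y²(y dx + 2x dy) + x³(x dy − y dx)`. -/
def OmF5 : Fin 3 → MvPolynomial (Fin 3) ℂ :=
  ![X 2 * X 1 ^ 3 - X 0 ^ 3 * X 1, 2 * X 0 * X 1 ^ 2 * X 2 + X 0 ^ 4,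
    -(3 * X 0 * X 1 ^ 3)]

abbrev V3 := Fin 3 → ℂ
abbrev Cf := Fin 3 → (Fin 3 →₀ ℕ) → ℂ

def lin (l x : V3) : ℂ := l 0 * x 0 + l 1 * x 1 + l 2 * x 2

def cr (l x : V3) : V3 := ![l 1 * x 2 - l 2 * x 1, l 2 * x 0 - l 0 * x 2, l 0 * x 1 - l 1 * x 0]

def det3 (x a b : V3) : ℂ := lin x (cr a b)

def om (f : V3 → V3) (x v : V3) : ℂ := lin (f x) v

def dd (g : V3 → Fin 3 → V3) (x v w : V3) : ℂ := lin (fun i => lin (g x i) v) w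

def qq (f : V3 → V3) (g : V3 → Fin 3 → V3) (x a b : V3) : ℂ :=
  dd g x (om f x a • b - om f x b • a) (om f x a • b - om f x b • a)

def RA (f : V3 → V3) (g : V3 → Fin 3 → V3) (e : V3) (l : Fin 3 → V3) : Prop :=
  ∀ x v w, lin (l 0) x * lin (l 1) x * lin (l 2) x * (dd g x v w - dd g x w v) =
    e 0 * lin (l 1) x * lin (l 2) x * (lin (l 0) v * om f x w - lin (l 0) w * om f x v) +
    e 1 * lin (l 0) x * lin (l 2) x * (lin (l 1) v * om f x w - lin (l 1) w * om f x v) +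
    e 2 * lin (l 0) x * lin (l 1) x * (lin (l 2) v * om f x w - lin (l 2) w * om f x v)

def PP (k : Fin 5 → ℕ) (l : Fin 6 → V3) (x : V3) : ℂ :=
  (∏ i : Fin 5, lin (l i.castSucc) x ^ k i) * lin (l 5) x

def RB (f : V3 → V3) (g : V3 → Fin 3 → V3) (k : Fin 5 → ℕ) (l : Fin 6 → V3) : Prop :=
  ∀ x a b x' a' b', qq f g x a b * det3 x' a' b' ^ 2 * PP k l x' =
    qq f g x' a' b' * det3 x a b ^ 2 * PP k l x

def InvL (f : V3 → V3) (l : V3) : Prop :=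
  ∀ x v, lin l x = 0 → lin l v = 0 → om f x v = 0

def InvC (f : V3 → V3) (l : V3) : Prop :=
  ∀ x v, om f (cr l x) (cr l v) = 0

lemma lin_cr (l x : V3) : lin l (cr l x) = 0 := by
  simp [lin, cr]; ring

lemma InvL.toC {f : V3 → V3} {l : V3} (h : InvL f l) : InvC f l :=
  fun x v => h _ _ (lin_cr l x) (lin_cr l v)

lemma lin_smul (r : ℂ) (l x : V3) : lin (r • l) x = r * lin l x := by
  simp [lin]; ring

lemma lin_smul_right (r : ℂ) (l x : V3) : lin l (r • x) = r * lin l x := by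
  simp [lin]; ring

lemma lin_sub_right (l x y : V3) : lin l (x - y) = lin l x - lin l y := by
  simp [lin]; ring

/- polynomial side -/
def fp (Ω : Fin 3 → MvPolynomial (Fin 3) ℂ) (x : V3) : V3 := fun i => eval x (Ω i)
def gp (Ω : Fin 3 → MvPolynomial (Fin 3) ℂ) (x : V3) : Fin 3 → V3 :=
  fun i j => eval x (pderiv j (Ω i))

lemma eval_subst3 (M : Matrix (Fin 3) (Fin 3) ℂ) (P : MvPolynomial (Fin 3) ℂ) (x : V3) :
    eval x (subst3 M P) = eval (M.mulVec x) P := by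
  unfold subst3
  induction P using MvPolynomial.induction_on with
  | C a => simp
  | add p q hp hq => simp only [map_add, hp, hq]
  | mul_X p i hp =>
    simp only [map_mul, hp, aeval_X, eval_X, map_sum, eval_C]
    rfl

lemma pderiv_subst3 (M : Matrix (Fin 3) (Fin 3) ℂ) (P : MvPolynomial (Fin 3) ℂ) (j : Fin 3) :
    pderiv j (subst3 M P) = ∑ t, C (M t j) * subst3 M (pderiv t P) := by
  unfold subst3
  induction P using MvPolynomial.induction_on with
  | C a => simp
  | add p q hp hq => simp only [map_add, hp, hq, mul_add, Finset.sum_add_distrib]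
  | mul_X p i hp =>
    have hX : (aeval (fun i => ∑ j, C (M i j) * X j) :
      MvPolynomial (Fin 3) ℂ →ₐ[ℂ] MvPolynomial (Fin 3) ℂ) (X i) =
        (∑ j, C (M i j) * X j : MvPolynomial (Fin 3) ℂ) := aeval_X _ _
    generalize (aeval (fun i => ∑ j, C (M i j) * X j) :
      MvPolynomial (Fin 3) ℂ →ₐ[ℂ] MvPolynomial (Fin 3) ℂ) = φ at *
    rw [map_mul, Derivation.leibniz, hp, hX]
    simp only [Derivation.leibniz, map_mul, map_add, smul_eq_mul, pderiv_X, map_sum, hX,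
      pderiv_C, Fin.sum_univ_three]
    fin_cases i <;> fin_cases j <;> simp [Pi.single_apply] <;> ring

lemma fp_pb3 (M : Matrix (Fin 3) (Fin 3) ℂ) (Ω) (x v : V3) :
    om (fp (pb3 M Ω)) x v = om (fp Ω) (M.mulVec x) (M.mulVec v) := by
  simp only [om, fp, pb3, lin, Fin.sum_univ_three, map_add, map_mul, eval_C, eval_subst3]
  simp only [Matrix.mulVec, dotProduct, Fin.sum_univ_three]
  ring

lemma gp_pb3 (M : Matrix (Fin 3) (Fin 3) ℂ) (Ω) (x v w : V3) :
    dd (gp (pb3 M Ω)) x v w = dd (gp Ω) (M.mulVec x) (M.mulVec v) (M.mulVec w) := by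
  simp only [dd, gp, pb3, lin, Fin.sum_univ_three, map_add, map_mul, eval_C, eval_subst3,
    Derivation.leibniz, pderiv_C, pderiv_subst3, smul_eq_mul, mul_zero, add_zero]
  generalize M.mulVec x = y
  simp only [Matrix.mulVec, dotProduct, Fin.sum_univ_three]
  ring

lemma fp_C (c : ℂ) (Ω) (x v : V3) :
    om (fp (fun i => C c * Ω i)) x v = c * om (fp Ω) x v := by
  simp [om, fp, lin]; ring

lemma gp_C (c : ℂ) (Ω) (x v w : V3) :
    dd (gp (fun i => C c * Ω i)) x v w = c * dd (gp Ω) x v w := by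
  simp [dd, gp, lin]; ring

/- coefficient side -/
def S4 : Finset (Fin 3 →₀ ℕ) := Finset.finsuppAntidiag Finset.univ 4

def fc (c : Cf) (x : V3) : V3 := fun i => ∑ m ∈ S4, c i m * eval x (monomial m (1:ℂ))
def gc (c : Cf) (x : V3) : Fin 3 → V3 :=
  fun i j => ∑ m ∈ S4, c i m * eval x (pderiv j (monomial m (1:ℂ)))

lemma hom_expand (P : MvPolynomial (Fin 3) ℂ) (h : P.IsHomogeneous 4) :
    P = ∑ m ∈ S4, C (coeff m P) * monomial m (1:ℂ) := by
  conv_lhs => rw [P.as_sum]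
  have : P.support ⊆ S4 := by
    intro m hm
    have h1 := h (mem_support_iff.mp hm)
    rw [S4, Finset.mem_finsuppAntidiag]
    refine ⟨?_, Finset.subset_univ _⟩
    rw [← h1, Finsupp.weight_apply, Finsupp.sum_fintype _ _ (by simp)]
    simp
  rw [Finset.sum_subset this]
  · refine Finset.sum_congr rfl fun m _ => ?_
    rw [C_mul_monomial, mul_one]
  · intro m _ hm
    rw [notMem_support_iff.mp hm, monomial_zero]

lemma fc_eq (Ω : Fin 3 → MvPolynomial (Fin 3) ℂ) (h : ∀ i, (Ω i).IsHomogeneous 4) :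
    fc (coeffs Ω) = fp Ω := by
  ext x i
  simp only [fc, fp, _root_.coeffs]
  conv_rhs => rw [hom_expand _ (h i)]
  simp only [map_sum, map_mul, eval_C]

lemma gc_eq (Ω : Fin 3 → MvPolynomial (Fin 3) ℂ) (h : ∀ i, (Ω i).IsHomogeneous 4) :
    gc (coeffs Ω) = gp Ω := by
  ext x i j
  simp only [gc, gp, _root_.coeffs]
  conv_rhs => rw [hom_expand _ (h i)]
  simp only [map_sum, map_mul, eval_C, Derivation.leibniz, pderiv_C, smul_eq_mul, mul_zero, add_zero,
    map_add]

lemma hom_orbit {Ω Ω' : Fin 3 → MvPolynomial (Fin 3) ℂ} (h : ∀ i, (Ω i).IsHomogeneous 4)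
    (ho : Ω' ∈ OrbitOf Ω) : ∀ i, (Ω' i).IsHomogeneous 4 := by
  obtain ⟨M, c, hM, hc, he⟩ := ho
  intro i
  have h1 : (pb3 M Ω i).IsHomogeneous 4 := by
    unfold pb3 subst3
    refine IsHomogeneous.sum _ _ _ fun j _ => ?_
    have h2 := (h j).aeval (fun i => ∑ j, C (M i j) * X j : Fin 3 → MvPolynomial (Fin 3) ℂ) (n := 1)
      (fun i => IsHomogeneous.sum _ _ _ fun t _ => by
        simpa using (isHomogeneous_C (Fin 3) (M i t)).mul (isHomogeneous_X ℂ t))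
    simpa using (isHomogeneous_C (Fin 3) (M j i)).mul h2
  rw [he] at h1
  have h3 : Ω' i = C c⁻¹ * (C c * Ω' i) := by
    rw [← mul_assoc, ← C_mul, inv_mul_cancel₀ hc, C_1, one_mul]
  rw [h3]
  simpa using (isHomogeneous_C (Fin 3) c⁻¹).mul h1

lemma cont_lin {T : Type*} [TopologicalSpace T] {a b : T → V3} (ha : Continuous a)
    (hb : Continuous b) : Continuous fun t => lin (a t) (b t) := by
  unfold lin; fun_prop

lemma cont_cr {T : Type*} [TopologicalSpace T] {a b : T → V3} (ha : Continuous a)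
    (hb : Continuous b) : Continuous fun t => cr (a t) (b t) := by
  refine continuous_pi fun i => ?_
  fin_cases i <;> simp [cr] <;> fun_prop

lemma cont_om {T : Type*} [TopologicalSpace T] {c : T → Cf} {a b : T → V3} (hc : Continuous c)
    (ha : Continuous a) (hb : Continuous b) : Continuous fun t => om (fc (c t)) (a t) (b t) := by
  unfold om
  refine cont_lin (continuous_pi fun i => ?_) hb
  unfold fc
  refine continuous_finsetSum _ fun m _ => ?_
  refine Continuous.mul (by fun_prop) ?_
  exact (MvPolynomial.continuous_eval _).comp ha

lemma cont_dd {T : Type*} [TopologicalSpace T] {c : T → Cf} {x a b : T → V3} (hc : Continuous c)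
    (hx : Continuous x) (ha : Continuous a) (hb : Continuous b) :
    Continuous fun t => dd (gc (c t)) (x t) (a t) (b t) := by
  unfold dd
  refine cont_lin (continuous_pi fun i => cont_lin (continuous_pi fun j => ?_) ha) hb
  unfold gc
  refine continuous_finsetSum _ fun m _ => ?_
  refine Continuous.mul (by fun_prop) ?_
  exact (MvPolynomial.continuous_eval _).comp hx

lemma closedA (e : V3) : IsClosed {p : Cf × (Fin 3 → V3) | RA (fc p.1) (gc p.1) e p.2} := by
  simp only [RA, Set.ofPred_forall]
  refine isClosed_iInter fun x => isClosed_iInter fun v => isClosed_iInter fun w => ?_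
  have hl : ∀ i y, Continuous fun p : Cf × (Fin 3 → V3) => lin (p.2 i) y :=
    fun i y => cont_lin (by fun_prop) continuous_const
  have ho : ∀ x y, Continuous fun p : Cf × (Fin 3 → V3) => om (fc p.1) x y :=
    fun x y => cont_om continuous_fst continuous_const continuous_const
  have hd : ∀ x y z, Continuous fun p : Cf × (Fin 3 → V3) => dd (gc p.1) x y z :=
    fun x y z => cont_dd continuous_fst continuous_const continuous_const continuous_const
  refine isClosed_eq ?_ ?_ <;> fun_prop

lemma closedB (k : Fin 5 → ℕ) : IsClosed {p : Cf × (Fin 6 → V3) |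
    (∀ i : Fin 5, InvC (fc p.1) (p.2 i.castSucc)) ∧ RB (fc p.1) (gc p.1) k p.2} := by
  simp only [RB, InvC, Set.ofPred_and, Set.ofPred_forall]
  have hl : ∀ i y, Continuous fun p : Cf × (Fin 6 → V3) => lin (p.2 i) y :=
    fun i y => cont_lin (by fun_prop) continuous_const
  have ho : ∀ x y, Continuous fun p : Cf × (Fin 6 → V3) => om (fc p.1) x y :=
    fun x y => cont_om continuous_fst continuous_const continuous_const
  have hP : ∀ x, Continuous fun p : Cf × (Fin 6 → V3) => PP k p.2 x := by
    intro x; unfold PP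
    exact (continuous_finsetProd _ fun i _ => (hl _ _).pow _).mul (hl _ _)
  have hq : ∀ x y z, Continuous fun p : Cf × (Fin 6 → V3) => qq (fc p.1) (gc p.1) x y z := by
    intro x y z; unfold qq
    refine cont_dd continuous_fst continuous_const ?_ ?_ <;>
    exact ((ho _ _).smul continuous_const).sub ((ho _ _).smul continuous_const)
  refine IsClosed.inter ?_ ?_
  · refine isClosed_iInter fun i => isClosed_iInter fun v => isClosed_iInter fun w => ?_
    exact isClosed_eq (cont_om continuous_fst (cont_cr (by fun_prop) continuous_const)
      (cont_cr (by fun_prop) continuous_const)) continuous_const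
  · refine isClosed_iInter fun x => isClosed_iInter fun v => isClosed_iInter fun w =>
      isClosed_iInter fun x' => isClosed_iInter fun v' => isClosed_iInter fun w' => ?_
    refine isClosed_eq ?_ ?_ <;> fun_prop

lemma clos {n : ℕ} (R : Cf → (Fin n → V3) → Prop)
    (hR : IsClosed {p : Cf × (Fin n → V3) | R p.1 p.2})
    (S : Set (Fin 3 → MvPolynomial (Fin 3) ℂ)) (F : Fin 3 → MvPolynomial (Fin 3) ℂ)
    (h : ∀ Ω ∈ S, ∃ l : Fin n → V3, (∀ i, ‖l i‖ = 1) ∧ R (coeffs Ω) l)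
    (hF : coeffs F ∈ closure (coeffs '' S)) :
    ∃ l : Fin n → V3, (∀ i, l i ≠ 0) ∧ R (coeffs F) l := by
  let K : Set (Fin n → V3) := Set.pi Set.univ fun _ => Metric.sphere (0 : V3) 1
  have hK : IsCompact K := isCompact_univ_pi fun _ => isCompact_sphere _ _
  have : CompactSpace K := isCompact_iff_compactSpace.mp hK
  have h1 : IsClosed {p : Cf × K | R p.1 p.2.1} :=
    hR.preimage (f := fun p : Cf × K => (p.1, p.2.1)) (by fun_prop)
  have h2 := isClosedMap_fst_of_compactSpace _ h1
  have h3 : coeffs '' S ⊆ Prod.fst '' {p : Cf × K | R p.1 p.2.1} := by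
    rintro _ ⟨Ω, hΩ, rfl⟩
    obtain ⟨l, hl, hr⟩ := h Ω hΩ
    exact ⟨(coeffs Ω, ⟨l, fun i _ => by simpa using hl i⟩), hr, rfl⟩
  obtain ⟨⟨c, l, hl⟩, hr, hc⟩ := closure_minimal h3 h2 hF
  simp only at hc
  subst hc
  refine ⟨l, fun i hi => ?_, hr⟩
  have := hl i trivial
  rw [hi] at this
  simp at this

lemma lin_vecMul (M : Matrix (Fin 3) (Fin 3) ℂ) (l x : V3) :
    lin (M.vecMul l) x = lin l (M.mulVec x) := by
  simp only [lin, Matrix.mulVec, Matrix.vecMul, dotProduct, Fin.sum_univ_three]; ring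

lemma det3_mul (M : Matrix (Fin 3) (Fin 3) ℂ) (x a b : V3) :
    det3 (M.mulVec x) (M.mulVec a) (M.mulVec b) = M.det * det3 x a b := by
  simp only [det3, lin, cr, Matrix.mulVec, dotProduct, Fin.sum_univ_three, Matrix.det_fin_three,
    Matrix.cons_val_zero, Matrix.cons_val_one, Matrix.cons_val]; ring

lemma vecMul_ne (M : Matrix (Fin 3) (Fin 3) ℂ) (hM : IsUnit M.det) (l : V3) (hl : l ≠ 0) :
    M.vecMul l ≠ 0 := by
  intro h
  have h2 : l = 0 := by
    have h4 := congrArg (fun v => M⁻¹.vecMul v) h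
    simpa [Matrix.vecMul_vecMul, Matrix.mul_nonsing_inv _ hM] using h4
  exact hl h2

lemma dd_lin (g : V3 → Fin 3 → V3) (x : V3) (r s : ℂ) (a b : V3) :
    dd g x ((r * s) • b) a = r * dd g x (s • b) a := by
  simp [dd, lin]; ring

lemma transferA {Ω Ω' : Fin 3 → MvPolynomial (Fin 3) ℂ} (ho : Ω' ∈ OrbitOf Ω) (e : V3)
    (l : Fin 3 → V3) (hl : ∀ i, l i ≠ 0) (h : RA (fp Ω) (gp Ω) e l) :
    ∃ l' : Fin 3 → V3, (∀ i, ‖l' i‖ = 1) ∧ RA (fp Ω') (gp Ω') e l' := by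
  obtain ⟨M, c, hM, hc, he⟩ := ho
  refine ⟨fun i => (‖M.vecMul (l i)‖⁻¹ : ℂ) • M.vecMul (l i), fun i => ?_, ?_⟩
  · have := norm_ne_zero_iff.mpr (vecMul_ne M hM _ (hl i))
    rw [norm_smul, norm_inv, Complex.norm_real, norm_norm, inv_mul_cancel₀ this]
  · intro x v w
    have h1 := fun x v => fp_pb3 M Ω x v
    have h2 := fun x v w => gp_pb3 M Ω x v w
    simp only [he, fp_C, gp_C] at h1 h2
    have h3 := h (M.mulVec x) (M.mulVec v) (M.mulVec w)
    simp only [← h1, ← h2] at h3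
    simp only [lin_smul, lin_vecMul]
    apply mul_left_cancel₀ hc
    linear_combination (‖M.vecMul (l 0)‖⁻¹ : ℂ) * (‖M.vecMul (l 1)‖⁻¹ : ℂ) *
      (‖M.vecMul (l 2)‖⁻¹ : ℂ) * h3

lemma transferB {Ω Ω' : Fin 3 → MvPolynomial (Fin 3) ℂ} (ho : Ω' ∈ OrbitOf Ω) (k : Fin 5 → ℕ)
    (l : Fin 6 → V3) (hl : ∀ i, l i ≠ 0) (h0 : ∀ i : Fin 5, InvL (fp Ω) (l i.castSucc))
    (h : RB (fp Ω) (gp Ω) k l) :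
    ∃ l' : Fin 6 → V3, (∀ i, ‖l' i‖ = 1) ∧ (∀ i : Fin 5, InvC (fp Ω') (l' i.castSucc)) ∧
      RB (fp Ω') (gp Ω') k l' := by
  obtain ⟨M, c, hM, hc, he⟩ := ho
  have hn := fun i => norm_ne_zero_iff.mpr (vecMul_ne M hM _ (hl i))
  have h1 := fun x v => fp_pb3 M Ω x v
  have h2 := fun x v w => gp_pb3 M Ω x v w
  simp only [he, fp_C, gp_C] at h1 h2
  refine ⟨fun i => (‖M.vecMul (l i)‖⁻¹ : ℂ) • M.vecMul (l i), fun i => ?_, fun i => ?_, ?_⟩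
  · rw [norm_smul, norm_inv, Complex.norm_real, norm_norm, inv_mul_cancel₀ (hn i)]
  · apply InvL.toC
    intro x v hx hv
    have hr : (‖M.vecMul (l i.castSucc)‖⁻¹ : ℂ) ≠ 0 := by
      exact inv_ne_zero (Complex.ofReal_ne_zero.mpr (hn _))
    rw [lin_smul, lin_vecMul] at hx hv
    have := h0 i _ _ ((mul_eq_zero.mp hx).resolve_left hr) ((mul_eq_zero.mp hv).resolve_left hr)
    rw [← h1] at this
    exact (mul_eq_zero.mp this).resolve_left hc
  · have hq : ∀ x a b, qq (fp Ω) (gp Ω) (M.mulVec x) (M.mulVec a) (M.mulVec b) =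
        c ^ 3 * qq (fp Ω') (gp Ω') x a b := by
      intro x a b
      have : ∀ a b : V3, om (fp Ω) (M.mulVec x) (M.mulVec a) • M.mulVec b -
          om (fp Ω) (M.mulVec x) (M.mulVec b) • M.mulVec a =
          M.mulVec (c • (om (fp Ω') x a • b - om (fp Ω') x b • a)) := by
        intro a b
        rw [← h1, ← h1]
        simp only [Matrix.mulVec_smul, Matrix.mulVec_sub, mul_smul, smul_sub]
      unfold qq
      rw [this, ← h2]
      simp only [dd, lin_smul_right]
      simp only [lin]
      ring
    have hP : ∀ x, PP k (fun i => (‖M.vecMul (l i)‖⁻¹ : ℂ) • M.vecMul (l i)) x =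
        PP k (fun i => (‖M.vecMul (l i)‖⁻¹ : ℂ) • ![1,0,0]) ![1,0,0] * PP k l (M.mulVec x) := by
      intro x
      simp only [PP, lin_smul, lin_vecMul, mul_pow, Finset.prod_mul_distrib]
      simp [lin]
      ring
    intro x a b x' a' b'
    have h3 := h (M.mulVec x) (M.mulVec a) (M.mulVec b) (M.mulVec x') (M.mulVec a') (M.mulVec b')
    simp only [hq, det3_mul] at h3
    rw [hP, hP]
    have hne : c ^ 3 * M.det ^ 2 ≠ 0 := mul_ne_zero (pow_ne_zero _ hc) (pow_ne_zero _ hM.ne_zero)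
    apply mul_left_cancel₀ hne
    linear_combination PP k (fun i => (‖M.vecMul (l i)‖⁻¹ : ℂ) • ![1,0,0]) ![1,0,0] * h3


lemma polyvanish (c0 c1 c2 c3 c4 c5 : ℂ)
    (h : ∀ y : ℂ, c0 + c1 * y + c2 * y ^ 2 + c3 * y ^ 3 + c4 * y ^ 4 + c5 * y ^ 5 = 0) :
    c2 = 0 ∧ c3 = 0 ∧ c4 = 0 ∧ c5 = 0 := by
  have h0 := h 0
  have h1 := h 1
  have h2 := h (-1)
  have h3 := h 2
  have h4 := h (-2)
  have h5 := h 3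
  norm_num at h0 h1 h2 h3 h4 h5
  have e4 : c4 = 0 := by linear_combination (1/24) * (h3 + h4 - 4 * (h1 + h2)) + (1/4) * h0
  have e2 : c2 = 0 := by linear_combination (1/2) * (h1 + h2) - h0 - e4
  have e5 : c5 = 0 := by
    linear_combination (1/120) * h5 - (1/24) * h3 + (1/12) * h1 - (1/12) * h0 + (1/24) * h2 - (1/120) * h4
  have e3 : c3 = 0 := by
    linear_combination (1/12) * (h3 - h4) - (1/6) * (h1 - h2) - 5 * e5
  exact ⟨e2, e3, e4, e5⟩

lemma pick (a c : V3) : ∃ t : ℂ, ∀ i, (a i ≠ 0 ∨ c i ≠ 0) → a i + c i * t ≠ 0 := by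
  obtain ⟨t, ht⟩ := Infinite.exists_notMem_finset (Finset.univ.image fun i => -a i / c i)
  refine ⟨t, fun i hi h => ?_⟩
  by_cases hc : c i = 0
  · simp [hc] at h hi
    exact hi h
  · apply ht
    simp only [Finset.mem_image, Finset.mem_univ, true_and]
    refine ⟨i, ?_⟩
    field_simp
    linear_combination -h

lemma F1_no (e : V3) (l : Fin 3 → V3) (hl : ∀ i, l i ≠ 0) (hR : RA (fp OmF1) (gp OmF1) e l)
    (hs : e 0 + e 1 + e 2 = 5)
    (h0 : e 0 ≠ 2) (h1 : e 1 ≠ 2) (h2 : e 2 ≠ 2)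
    (h01 : e 0 + e 1 ≠ 2) (h02 : e 0 + e 2 ≠ 2) (h12 : e 1 + e 2 ≠ 2) : False := by
  obtain ⟨t, ht⟩ := pick (fun i => l i 0) (fun i => l i 2)
  have hb : ∀ i, l i 1 = 0 → l i 0 + l i 2 * t ≠ 0 := by
    intro i hi
    apply ht
    by_contra! hc
    apply hl i
    ext j
    fin_cases j
    · exact hc.1
    · exact hi
    · exact hc.2
  set m0 := l 0 0 + l 0 2 * t with hm0
  set m1 := l 1 0 + l 1 2 * t with hm1
  set m2 := l 2 0 + l 2 2 * t with hm2
  have key := fun y : ℂ => hR ![1, y, t] ![y ^ 2, 0, t * y ^ 2 - 1] ![0, 1, 0]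
  simp [om, dd, fp, gp, OmF1, lin, Derivation.leibniz, pderiv_X, Pi.single_apply] at key
  obtain ⟨k2, k3, k4, k5⟩ := polyvanish
    (-(e 0 * l 0 2 * m1 * m2 + e 1 * l 1 2 * m0 * m2 + e 2 * l 2 2 * m0 * m1))
    (-(e 0 * l 0 2 * (m1 * l 2 1 + m2 * l 1 1) + e 1 * l 1 2 * (m0 * l 2 1 + m2 * l 0 1)
      + e 2 * l 2 2 * (m0 * l 1 1 + m1 * l 0 1)))
    (3 * m0 * m1 * m2 - (e 0 * l 0 2 * l 1 1 * l 2 1 + e 1 * l 1 2 * l 0 1 * l 2 1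
      + e 2 * l 2 2 * l 0 1 * l 1 1))
    (l 0 1 * m1 * m2 * (e 1 + e 2 - 2) + l 1 1 * m0 * m2 * (e 0 + e 2 - 2) +
      l 2 1 * m0 * m1 * (e 0 + e 1 - 2))
    ((e 0 - 2) * m0 * l 1 1 * l 2 1 + (e 1 - 2) * m1 * l 0 1 * l 2 1 +
      (e 2 - 2) * m2 * l 0 1 * l 1 1)
    (-2 * l 0 1 * l 1 1 * l 2 1) (by
      intro y
      simp only [hm0, hm1, hm2]
      linear_combination - key y - y ^ 2 * (l 0 0 + l 0 2 * t) * (l 1 0 + l 1 2 * t) * (l 2 0 + l 2 2 * t) * hs)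
  have n0 := hb 0
  have n1 := hb 1
  have n2 := hb 2
  rw [← hm0] at n0
  rw [← hm1] at n1
  rw [← hm2] at n2
  have d0 := sub_ne_zero.mpr h0
  have d1 := sub_ne_zero.mpr h1
  have d2 := sub_ne_zero.mpr h2
  have d01 := sub_ne_zero.mpr h01
  have d02 := sub_ne_zero.mpr h02
  have d12 := sub_ne_zero.mpr h12
  clear key hR hb ht
  by_cases b0 : l 0 1 = 0 <;> by_cases b1 : l 1 1 = 0 <;> by_cases b2 : l 2 1 = 0 <;>
    simp_all

lemma F2_inv (l : V3) (h : InvC (fp OmF2) l) : l 1 = 0 ∧ l 2 = 0 := by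
  have e1 := h ![1,0,0] ![0,1,0]
  have e2 := h ![0,0,1] ![1,0,0]
  simp [om, fp, OmF2, lin, cr] at e1 e2
  have h2 : l 2 = 0 := by tauto
  simp [h2] at e2
  exact ⟨by tauto, h2⟩

lemma F2_no (k : Fin 5 → ℕ) (l : Fin 6 → V3) (hl : ∀ i, l i ≠ 0)
    (h0 : ∀ i : Fin 5, InvC (fp OmF2) (l i.castSucc)) (hR : RB (fp OmF2) (gp OmF2) k l) : False := by
  have hq : ∀ y z : ℂ, qq (fp OmF2) (gp OmF2) ![1,y,z] ![0,1,0] ![0,0,1] = 3 * y ^ 2 := by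
    intro y z
    simp [qq, om, dd, fp, gp, OmF2, lin, Derivation.leibniz, pderiv_X, Pi.single_apply]
  have hD : ∀ y z : ℂ, det3 ![1,y,z] ![0,1,0] ![0,0,1] = 1 := by
    intro y z; simp [det3, lin, cr]
  have hP : ∀ y z : ℂ, PP k l ![1,y,z] = (∏ i : Fin 5, l i.castSucc 0 ^ k i) *
      (l 5 0 + l 5 1 * y + l 5 2 * z) := by
    intro y z
    unfold PP
    congr 1
    · refine Finset.prod_congr rfl fun i _ => ?_
      obtain ⟨p, q⟩ := F2_inv _ (h0 i)
      simp [lin, p, q]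
    · simp [lin]
  have hK : (∏ i : Fin 5, l i.castSucc 0 ^ k i) ≠ 0 := by
    refine Finset.prod_ne_zero_iff.mpr fun i _ => pow_ne_zero _ fun h => hl i.castSucc ?_
    obtain ⟨p, q⟩ := F2_inv _ (h0 i)
    ext j; fin_cases j
    · exact h
    · exact p
    · exact q
  have key := fun y z y' z' : ℂ =>
    hR ![1,y,z] ![0,1,0] ![0,0,1] ![1,y',z'] ![0,1,0] ![0,0,1]
  simp only [hq, hD, hP] at key
  generalize (∏ i : Fin 5, l i.castSucc 0 ^ k i) = K at *
  have a0 : l 5 0 = 0 := by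
    have := key 1 0 0 0; simp [hK] at this; exact this
  have a2 : l 5 2 = 0 := by
    have := key 1 0 0 1; simp [hK, a0] at this; exact this
  have a1 : l 5 1 = 0 := by
    have := key 1 0 2 0
    apply mul_left_cancel₀ hK
    simp only [a0, a2] at this
    linear_combination (-1/6) * this
  apply hl 5
  ext j; fin_cases j
  · exact a0
  · exact a1
  · exact a2

lemma F1_main (Ω) (hΩ : ∀ i, (Ω i).IsHomogeneous 4) (e : V3) (l : Fin 3 → V3)
    (hl : ∀ i, l i ≠ 0) (h : RA (fp Ω) (gp Ω) e l) (hs : e 0 + e 1 + e 2 = 5)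
    (h0 : e 0 ≠ 2) (h1 : e 1 ≠ 2) (h2 : e 2 ≠ 2)
    (h01 : e 0 + e 1 ≠ 2) (h02 : e 0 + e 2 ≠ 2) (h12 : e 1 + e 2 ≠ 2) :
    OmF1 ∉ FClos 3 (OrbitOf Ω) := by
  rintro ⟨hF, hcl⟩
  obtain ⟨l', hl', hr⟩ := clos (fun c l => RA (fc c) (gc c) e l) (closedA e) (OrbitOf Ω) OmF1 (by
    intro Ω' ho
    rw [fc_eq _ (hom_orbit hΩ ho), gc_eq _ (hom_orbit hΩ ho)]
    exact transferA ho e l hl h) hcl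
  rw [fc_eq _ hF.2.1, gc_eq _ hF.2.1] at hr
  exact F1_no e l' hl' hr hs h0 h1 h2 h01 h02 h12

lemma F2_main (Ω) (hΩ : ∀ i, (Ω i).IsHomogeneous 4) (k : Fin 5 → ℕ) (l : Fin 6 → V3)
    (hl : ∀ i, l i ≠ 0) (h0 : ∀ i : Fin 5, InvL (fp Ω) (l i.castSucc))
    (κ : ℂ) (h : ∀ x a b, qq (fp Ω) (gp Ω) x a b = κ * det3 x a b ^ 2 * PP k l x) :
    OmF2 ∉ FClos 3 (OrbitOf Ω) := by
  rintro ⟨hF, hcl⟩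
  have hB : RB (fp Ω) (gp Ω) k l := by
    intro x a b x' a' b'
    rw [h, h]; ring
  obtain ⟨l', hl', hi, hr⟩ := clos (fun c (l : Fin 6 → V3) =>
      (∀ i : Fin 5, InvC (fc c) (l i.castSucc)) ∧ RB (fc c) (gc c) k l)
      (closedB k) (OrbitOf Ω) OmF2 (by
    intro Ω' ho
    rw [fc_eq _ (hom_orbit hΩ ho), gc_eq _ (hom_orbit hΩ ho)]
    exact transferB ho k l hl h0 hB) hcl
  rw [fc_eq _ hF.2.1] at hi hr
  rw [gc_eq _ hF.2.1] at hr
  exact F2_no k l' hl' hi hr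


lemma pderiv_num (i : Fin 3) (n : ℕ) [n.AtLeastTwo] :
    pderiv i (ofNat(n) : MvPolynomial (Fin 3) ℂ) = 0 := by
  have := pderiv_C (R := ℂ) (i := i) (a := (OfNat.ofNat n : ℂ))
  rwa [map_ofNat] at this

lemma hmul {φ ψ : MvPolynomial (Fin 3) ℂ} {m n k : ℕ} (h1 : φ.IsHomogeneous m)
    (h2 : ψ.IsHomogeneous n) (h : m + n = k) : (φ * ψ).IsHomogeneous k := h ▸ h1.mul h2
lemma hadd {φ ψ : MvPolynomial (Fin 3) ℂ} {m n : ℕ} (h1 : φ.IsHomogeneous m)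
    (h2 : ψ.IsHomogeneous n) (h : n = m) : (φ + ψ).IsHomogeneous m := h1.add (h ▸ h2)
lemma hsub {φ ψ : MvPolynomial (Fin 3) ℂ} {m n : ℕ} (h1 : φ.IsHomogeneous m)
    (h2 : ψ.IsHomogeneous n) (h : n = m) : (φ - ψ).IsHomogeneous m := h1.sub (h ▸ h2)
lemma hpow (i : Fin 3) (k : ℕ) : (X i ^ k : MvPolynomial (Fin 3) ℂ).IsHomogeneous k := by
  simpa using (isHomogeneous_X ℂ i).pow k
lemma hnum (n : ℕ) [n.AtLeastTwo] :
    (OfNat.ofNat n : MvPolynomial (Fin 3) ℂ).IsHomogeneous 0 := by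
  have := isHomogeneous_C (Fin 3) (OfNat.ofNat n : ℂ)
  rwa [map_ofNat] at this

lemma homH2 : ∀ i, (OmH2 i).IsHomogeneous 4 := by
  intro i; fin_cases i <;> simp only [OmH2, Fin.zero_eta, Fin.mk_one, Fin.reduceFinMk, Matrix.cons_val_zero, Matrix.cons_val_one, Matrix.cons_val] <;>
  repeat' first | exact isHomogeneous_C _ _ | exact hnum _ | exact hpow _ _ | exact isHomogeneous_X _ _ | apply IsHomogeneous.neg | apply hadd | apply hsub | apply hmul | rfl
lemma homH8 : ∀ i, (OmH8 i).IsHomogeneous 4 := by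
  intro i; fin_cases i <;> simp only [OmH8, Fin.zero_eta, Fin.mk_one, Fin.reduceFinMk, Matrix.cons_val_zero, Matrix.cons_val_one, Matrix.cons_val] <;>
  repeat' first | exact isHomogeneous_C _ _ | exact hnum _ | exact hpow _ _ | exact isHomogeneous_X _ _ | apply IsHomogeneous.neg | apply hadd | apply hsub | apply hmul | rfl
lemma homH11 : ∀ i, (OmH11 i).IsHomogeneous 4 := by
  intro i; fin_cases i <;> simp only [OmH11, Fin.zero_eta, Fin.mk_one, Fin.reduceFinMk, Matrix.cons_val_zero, Matrix.cons_val_one, Matrix.cons_val] <;>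
  repeat' first | exact isHomogeneous_C _ _ | exact hnum _ | exact hpow _ _ | exact isHomogeneous_X _ _ | apply IsHomogeneous.neg | apply hadd | apply hsub | apply hmul | rfl
lemma homF5 : ∀ i, (OmF5 i).IsHomogeneous 4 := by
  intro i; fin_cases i <;> simp only [OmF5, Fin.zero_eta, Fin.mk_one, Fin.reduceFinMk, Matrix.cons_val_zero, Matrix.cons_val_one, Matrix.cons_val] <;>
  repeat' first | exact isHomogeneous_C _ _ | exact hnum _ | exact hpow _ _ | exact isHomogeneous_X _ _ | apply IsHomogeneous.neg | apply hadd | apply hsub | apply hmul | rfl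
lemma homH5 : ∀ i, (OmH5 i).IsHomogeneous 4 := by
  intro i; fin_cases i <;> simp only [OmH5, Fin.zero_eta, Fin.mk_one, Fin.reduceFinMk, Matrix.cons_val_zero, Matrix.cons_val_one, Matrix.cons_val] <;>
  repeat' first | exact isHomogeneous_C _ _ | exact hnum _ | exact hpow _ _ | exact isHomogeneous_X _ _ | apply IsHomogeneous.neg | apply hadd | apply hsub | apply hmul | rfl
lemma homH9 : ∀ i, (OmH9 i).IsHomogeneous 4 := by
  intro i; fin_cases i <;> simp only [OmH9, Fin.zero_eta, Fin.mk_one, Fin.reduceFinMk, Matrix.cons_val_zero, Matrix.cons_val_one, Matrix.cons_val] <;>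
  repeat' first | exact isHomogeneous_C _ _ | exact hnum _ | exact hpow _ _ | exact isHomogeneous_X _ _ | apply IsHomogeneous.neg | apply hadd | apply hsub | apply hmul | rfl

lemma nonF1_H2 : OmF1 ∉ FClos 3 (OrbitOf OmH2) := by
  refine F1_main OmH2 homH2 ![5,0,0] ![![0,0,1],![0,0,1],![0,0,1]] ?_ ?_ ?_ ?_ ?_ ?_ ?_ ?_ ?_
  · intro i; fin_cases i <;> simp
  · intro x v w
    simp [om, dd, fp, gp, OmH2, lin, Derivation.leibniz, pderiv_X, pderiv_num, Pi.single_apply]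
    ring
  all_goals (simp only [Matrix.cons_val, Matrix.cons_val_zero, Matrix.cons_val_one]; norm_num)

lemma nonF1_H8 : OmF1 ∉ FClos 3 (OrbitOf OmH8) := by
  refine F1_main OmH8 homH8 ![3/4,3/4,7/2] ![![1,-2,0],![1,2,0],![0,0,1]] ?_ ?_ ?_ ?_ ?_ ?_ ?_ ?_ ?_
  · intro i; fin_cases i <;> simp
  · intro x v w
    simp [om, dd, fp, gp, OmH8, lin, Derivation.leibniz, pderiv_X, pderiv_num, Pi.single_apply]
    ring
  all_goals (simp only [Matrix.cons_val, Matrix.cons_val_zero, Matrix.cons_val_one]; norm_num)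

lemma nonF1_H11 : OmF1 ∉ FClos 3 (OrbitOf OmH11) := by
  refine F1_main OmH11 homH11 ![5,0,0] ![![0,0,1],![0,0,1],![0,0,1]] ?_ ?_ ?_ ?_ ?_ ?_ ?_ ?_ ?_
  · intro i; fin_cases i <;> simp
  · intro x v w
    simp [om, dd, fp, gp, OmH11, lin, Derivation.leibniz, pderiv_X, pderiv_num, Pi.single_apply]
    ring
  all_goals (simp only [Matrix.cons_val, Matrix.cons_val_zero, Matrix.cons_val_one]; norm_num)

lemma nonF1_F5 : OmF1 ∉ FClos 3 (OrbitOf OmF5) := by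
  refine F1_main OmF5 homF5 ![4/3,11/3,0] ![![1,0,0],![0,1,0],![0,1,0]] ?_ ?_ ?_ ?_ ?_ ?_ ?_ ?_ ?_
  · intro i; fin_cases i <;> simp
  · intro x v w
    simp [om, dd, fp, gp, OmF5, lin, Derivation.leibniz, pderiv_X, pderiv_num, Pi.single_apply]
    ring
  all_goals (simp only [Matrix.cons_val, Matrix.cons_val_zero, Matrix.cons_val_one]; norm_num)

lemma hom_q (A B Ax Ay Bx By : ℂ) (x a b : V3) (f : V3 → V3) (g : V3 → Fin 3 → V3)
    (hA : A = (x 0 * Ax + x 1 * Ay) / 3) (hB : B = (x 0 * Bx + x 1 * By) / 3)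
    (hf : f x = ![x 2 * A, x 2 * B, -(x 0 * A + x 1 * B)])
    (hg : g x = ![![x 2 * Ax, x 2 * Ay, A], ![x 2 * Bx, x 2 * By, B],
      ![-(A + x 0 * Ax + x 1 * Bx), -(x 0 * Ay + B + x 1 * By), 0]]) :
    qq f g x a b = det3 x a b ^ 2 * (x 2 * (x 0 * A + x 1 * B) * (Ax * By - Ay * Bx) / 3) := by
  simp [qq, det3, cr, om, dd, hf, hg, lin]
  rw [hA, hB]
  ring

lemma nonF2_H5 : OmF2 ∉ FClos 3 (OrbitOf OmH5) := by
  refine F2_main OmH5 homH5 ![1,2,3,1,1]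
    ![![0,0,1],![1,0,0],![0,1,0],![-1,2,0],![2,1,0],![1,-1,0]] ?_ ?_ 12 ?_
  · intro i; fin_cases i <;> simp
  · intro i x v hx hv
    fin_cases i <;> simp [lin] at hx hv <;> simp [om, fp, OmH5, lin]
    · simp [hx, hv]
    · simp [hx, hv]
    · simp [hx, hv]
    · have h1 : x 0 = 2 * x 1 := by linear_combination -hx
      have h2 : v 0 = 2 * v 1 := by linear_combination -hv
      rw [h1, h2]; ring
    · have h1 : x 1 = -2 * x 0 := by linear_combination hx
      have h2 : v 1 = -2 * v 0 := by linear_combination hv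
      rw [h1, h2]; ring
  · intro x a b
    rw [hom_q (2 * x 1 ^ 3) (3 * x 0 ^ 2 * x 1 - 2 * x 0 ^ 3)
      0 (6 * x 1 ^ 2) (6 * x 0 * x 1 - 6 * x 0 ^ 2) (3 * x 0 ^ 2)
      x a b (fp OmH5) (gp OmH5) (by ring) (by ring)
      (by
        ext i; fin_cases i <;> simp [fp, OmH5] <;> ring)
      (by
        ext i k; fin_cases i <;> fin_cases k <;>
          simp [gp, OmH5, Derivation.leibniz, pderiv_X, pderiv_num, Pi.single_apply] <;> (try left) <;> ring)]
    have hP : PP ![1,2,3,1,1] ![![0,0,1],![1,0,0],![0,1,0],![-1,2,0],![2,1,0],![1,-1,0]] x =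
        x 2 * x 0 ^ 2 * x 1 ^ 3 * (2 * x 1 - x 0) * (2 * x 0 + x 1) * (x 0 - x 1) := by
      simp [PP, Fin.prod_univ_five, lin]
      ring
    rw [hP]
    ring

lemma s3sq : (Complex.I * s3) ^ 2 = -3 := by
  rw [mul_pow, Complex.I_sq, s3, ← Complex.ofReal_pow, Real.sq_sqrt (by norm_num)]; norm_num

lemma nonF2_H9 : OmF2 ∉ FClos 3 (OrbitOf OmH9) := by
  have hj := s3sq
  refine F2_main OmH9 homH9 ![1,2,2,2,1]
    ![![0,0,1],![1,0,0],![0,1,0],![1,-1,0],![1 + Complex.I * s3,-2,0],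
      ![3 + Complex.I * s3, -2 * (Complex.I * s3),0]] ?_ ?_ 4 ?_
  · intro i; fin_cases i <;> simp
    intro h h'
    have : s3 = 0 := h'
    rw [this] at hj; norm_num at hj
  · intro i x v hx hv
    have e : ∀ x v : V3, om (fp OmH9) x v = x 2 * ((-3 + Complex.I * s3) * x 0 * x 1 ^ 2 + 2 * x 1 ^ 3) * v 0 +
        x 2 * ((1 + Complex.I * s3) * x 0 ^ 3 - 2 * (Complex.I * s3) * x 0 ^ 2 * x 1) * v 1 -
        ((1 + Complex.I * s3) * x 0 ^ 3 * x 1 + (-3 - Complex.I * s3) * x 0 ^ 2 * x 1 ^ 2 +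
      2 * x 0 * x 1 ^ 3) * v 2 := by
      intro x v
      simp [om, fp, OmH9, lin]
      ring
    rw [e]
    generalize Complex.I * s3 = j at *
    fin_cases i <;> simp [lin] at hx hv
    · simp [hx, hv]
    · simp [hx, hv]
    · simp [hx, hv]
    · have h1 : x 0 = x 1 := by linear_combination hx
      have h2 : v 0 = v 1 := by linear_combination hv
      rw [h1, h2]; ring
    · have h1 : x 1 = (1 + j) / 2 * x 0 := by linear_combination -hx / 2
      have h2 : v 1 = (1 + j) / 2 * v 0 := by linear_combination -hv / 2
      rw [h1, h2]; ring
  · intro x a b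
    rw [hom_q ((-3 + Complex.I * s3) * x 0 * x 1 ^ 2 + 2 * x 1 ^ 3)
      ((1 + Complex.I * s3) * x 0 ^ 3 - 2 * (Complex.I * s3) * x 0 ^ 2 * x 1)
      ((-3 + Complex.I * s3) * x 1 ^ 2) (2 * (-3 + Complex.I * s3) * x 0 * x 1 + 6 * x 1 ^ 2)
      (3 * (1 + Complex.I * s3) * x 0 ^ 2 - 4 * (Complex.I * s3) * x 0 * x 1)
      (- 2 * (Complex.I * s3) * x 0 ^ 2) x a b (fp OmH9) (gp OmH9) (by ring) (by ring)
      (by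
        ext i; fin_cases i <;> simp [fp, OmH9] <;> ring)
      (by
        ext i k; fin_cases i <;> fin_cases k <;>
          simp [gp, OmH9, Derivation.leibniz, pderiv_X, pderiv_num, Pi.single_apply] <;> (try left) <;> ring)]
    have hP : PP ![1,2,2,2,1] ![![0,0,1],![1,0,0],![0,1,0],![1,-1,0],![1 + Complex.I * s3,-2,0],
      ![3 + Complex.I * s3, -2 * (Complex.I * s3),0]] x = x 2 * x 0 ^ 2 * x 1 ^ 2 * (x 0 - x 1) ^ 2 *
        ((1 + Complex.I * s3) * x 0 - 2 * x 1) *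
        ((3 + Complex.I * s3) * x 0 - 2 * (Complex.I * s3) * x 1) := by
      simp [PP, Fin.prod_univ_five, lin]
      ring
    rw [hP]
    generalize Complex.I * s3 = j at *
    have h3 : j ^ 3 = -3 * j := by linear_combination j * hj
    have h4 : j ^ 4 = 9 := by linear_combination (j ^ 2 - 3) * hj
    have key : ∀ D L P : ℂ, L = 4 * P → D * L = 4 * D * P := by
      intro D L P h
      rw [h]; ring
    apply key
    ring_nf; simp only [hj, h3, h4]; ring


/-- **Non-degenerations onto `F₁` and `F₂`.**
In `F(3)`, the foliations `H₂, H₈, H₁₁, F₅` do not degenerate onto `F₁` (the 1-form of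
`F₁` does not belong to the closure of any of their orbits), and the foliations
`H₅, H₉` do not degenerate onto `F₂`. -/
theorem stmt_18 :
    OmF1 ∉ FClos 3 (OrbitOf OmH2) ∧
    OmF1 ∉ FClos 3 (OrbitOf OmH8) ∧
    OmF1 ∉ FClos 3 (OrbitOf OmH11) ∧
    OmF1 ∉ FClos 3 (OrbitOf OmF5) ∧
    OmF2 ∉ FClos 3 (OrbitOf OmH5) ∧
    OmF2 ∉ FClos 3 (OrbitOf OmH9) := by
  exact ⟨nonF1_H2, nonF1_H8, nonF1_H11, nonF1_F5, nonF2_H5, nonF2_H9⟩
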